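/- Let 0 < α < 1 and let f : [0,∞) → ℝ be continuously differentiable with f and f′ of at most exponential order c ≥ 0 (i.e., |f(t)| ≤ M e^{ct} and |f′(t)| ≤ M e^{ct} for some M > 0). Then for every s > c, the Laplace transform of the left Caputo derivative satisfies ∫₀^∞ e^{−st} (ᶜD^α_{0+} f)(t) dt = s^α F(s) − s^{α−1} f(0), where F(s) = ∫₀^∞ e^{−st} f(t) dt, and all integrals converge. -/

import Mathlib

open MeasureTheory Set

/-- The left Caputo derivative of order `α` with base point `a`:
`(ᶜD^α_{a+} f)(t) = (1/Γ(1−α)) ∫_a^t (t−τ)^{−α} f′(τ) dτ`. -/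
noncomputable def caputoL (a α : ℝ) (f : ℝ → ℝ) (t : ℝ) : ℝ :=
  (Real.Gamma (1 - α))⁻¹ * ∫ τ in a..t, (t - τ) ^ (-α) * deriv f τ

open Filter Topology

theorem expOrder_integrable (g : ℝ → ℝ) (hg : Continuous g) (M c s : ℝ) (hs : c < s)
    (hb : ∀ t : ℝ, 0 ≤ t → |g t| ≤ M * Real.exp (c * t)) :
    IntegrableOn (fun t : ℝ => Real.exp (-s * t) * g t) (Ioi 0) := by
  have h1 : IntegrableOn (fun t : ℝ => M * Real.exp (-(s - c) * t)) (Ioi 0) :=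
    (exp_neg_integrableOn_Ioi 0 (sub_pos.2 hs)).const_mul M
  refine Integrable.mono' h1 (Continuous.aestronglyMeasurable (by fun_prop)) ?_
  refine (ae_restrict_mem measurableSet_Ioi).mono fun t ht => ?_
  have := hb t (le_of_lt ht)
  rw [Real.norm_eq_abs, abs_mul, abs_of_pos (Real.exp_pos _)]
  have e : Real.exp (-(s - c) * t) = Real.exp (-s * t) * Real.exp (c * t) := by
    rw [← Real.exp_add]; ring_nf
  rw [e]
  nlinarith [Real.exp_pos (-s * t)]

theorem expOrder_tendsto (g : ℝ → ℝ) (M c s : ℝ) (hs : c < s)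
    (hb : ∀ t : ℝ, 0 ≤ t → |g t| ≤ M * Real.exp (c * t)) :
    Tendsto (fun t : ℝ => Real.exp (-s * t) * g t) atTop (𝓝 0) := by
  have h1 : Tendsto (fun t : ℝ => M * Real.exp (-((s - c) * t))) atTop (𝓝 0) := by
    have := (Real.tendsto_exp_neg_atTop_nhds_zero.comp
      (tendsto_id.const_mul_atTop (sub_pos.2 hs))).const_mul M
    simpa using this
  refine squeeze_zero_norm' ?_ h1
  filter_upwards [eventually_ge_atTop 0] with t ht
  have := hb t ht
  rw [Real.norm_eq_abs, abs_mul, abs_of_pos (Real.exp_pos _)]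
  have e : Real.exp (-((s - c) * t)) = Real.exp (-s * t) * Real.exp (c * t) := by
    rw [← Real.exp_add]; ring_nf
  rw [e]
  nlinarith [Real.exp_pos (-s * t)]

/-- Laplace transform of the left Caputo derivative:
`L[ᶜD^α_{0+} f](s) = s^α F(s) − s^{α−1} f(0)` for `s > c`, where `f, f′` are of
exponential order `c`; all integrals converge. -/
theorem laplace_caputo (α : ℝ) (hα0 : 0 < α) (hα1 : α < 1)
    (f : ℝ → ℝ) (hf : ContDiff ℝ 1 f)
    (M c : ℝ) (hM : 0 < M) (hc : 0 ≤ c)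
    (hfb : ∀ t : ℝ, 0 ≤ t → |f t| ≤ M * Real.exp (c * t))
    (hfb' : ∀ t : ℝ, 0 ≤ t → |deriv f t| ≤ M * Real.exp (c * t)) :
    ∀ s : ℝ, c < s →
      IntegrableOn (fun t : ℝ => Real.exp (-s * t) * f t) (Ioi 0) ∧
      IntegrableOn (fun t : ℝ => Real.exp (-s * t) * caputoL 0 α f t) (Ioi 0) ∧
      ∫ t in Ioi (0 : ℝ), Real.exp (-s * t) * caputoL 0 α f t
        = s ^ α * (∫ t in Ioi (0 : ℝ), Real.exp (-s * t) * f t) - s ^ (α - 1) * f 0 := by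
  intro s hs
  have hs0 : 0 < s := lt_of_le_of_lt hc hs
  have hf'c : Continuous (deriv f) := hf.continuous_deriv le_rfl
  have hF := expOrder_integrable f hf.continuous M c s hs hfb
  have hp := expOrder_integrable (deriv f) hf'c M c s hs hfb'
  have hG : 0 < Real.Gamma (1 - α) := Real.Gamma_pos_of_pos (by linarith)
  have hkv : ∫ t in Ioi (0 : ℝ), Real.exp (-s * t) * t ^ (-α)
      = s ^ (α - 1) * Real.Gamma (1 - α) := by
    have h := Real.integral_rpow_mul_exp_neg_mul_Ioi (a := 1 - α) (r := s) (by linarith) hs0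
    have e : (1 / s) ^ (1 - α) = s ^ (α - 1) := by
      rw [one_div, Real.inv_rpow hs0.le, ← Real.rpow_neg hs0.le]; ring_nf
    rw [e] at h
    rw [← h]
    congr 1
    ext t
    rw [mul_comm]
    ring_nf
  have hk : IntegrableOn (fun t : ℝ => Real.exp (-s * t) * t ^ (-α)) (Ioi 0) := by
    by_contra hn
    have h0 := integral_undef hn
    rw [hkv] at h0
    have : 0 < s ^ (α - 1) * Real.Gamma (1 - α) := by positivity
    linarith
  have key : ∀ x : ℝ, (∫ t in (0 : ℝ)..x, ContinuousLinearMap.mul ℝ ℝ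
      (Real.exp (-s * t) * deriv f t) (Real.exp (-s * (x - t)) * (x - t) ^ (-α)))
      = Real.Gamma (1 - α) * (Real.exp (-s * x) * caputoL 0 α f x) := by
    intro x
    have : Real.Gamma (1 - α) * (Real.exp (-s * x) * caputoL 0 α f x)
        = Real.exp (-s * x) * ∫ τ in (0 : ℝ)..x, (x - τ) ^ (-α) * deriv f τ := by
      unfold caputoL
      field_simp
    rw [this, ← intervalIntegral.integral_const_mul]
    congr 1
    ext t
    have e : Real.exp (-s * x) = Real.exp (-s * t) * Real.exp (-s * (x - t)) := by
      rw [← Real.exp_add]; ring_nf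
    rw [ContinuousLinearMap.mul_apply', e]
    ring
  have hI := integral_posConvolution hp hk (ContinuousLinearMap.mul ℝ ℝ)
  have hJ := integrable_posConvolution hp hk (ContinuousLinearMap.mul ℝ ℝ)
  simp only [key] at hI
  rw [integral_const_mul, ContinuousLinearMap.mul_apply', hkv] at hI
  have hparts : ∫ t in Ioi (0 : ℝ), Real.exp (-s * t) * deriv f t
      = s * (∫ t in Ioi (0 : ℝ), Real.exp (-s * t) * f t) - f 0 := by
    have h := integral_Ioi_mul_deriv_eq_deriv_mul (a := 0) (a' := f 0) (b' := 0)
      (u := fun t : ℝ => Real.exp (-s * t)) (u' := fun t : ℝ => -s * Real.exp (-s * t))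
      (v := f) (v' := deriv f)
      (fun x _ => by
        have := ((hasDerivAt_id x).const_mul (-s)).exp
        simpa [mul_comm] using this)
      (fun x _ => (hf.differentiable one_ne_zero x).hasDerivAt)
      hp
      (by
        have := hF.const_mul (-s)
        refine this.congr (Eventually.of_forall fun t => ?_)
        simp [mul_assoc])
      (by
        have hcont : Continuous (fun t : ℝ => Real.exp (-s * t) * f t) := by
          have := hf.continuous
          fun_prop
        have := (hcont.tendsto 0).mono_left (nhdsWithin_le_nhds (s := Ioi 0))
        have h0 : Real.exp (-s * 0) * f 0 = f 0 := by simp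
        rw [h0] at this
        exact this)
      (expOrder_tendsto f M c s hs hfb)
    rw [h]
    simp only [mul_assoc, integral_const_mul]
    ring
  refine ⟨hF, ?_, ?_⟩
  · have h2 : IntegrableOn (fun x => Real.Gamma (1 - α) *
        (Real.exp (-s * x) * caputoL 0 α f x)) (Ioi 0) := by
      refine (hJ.integrableOn (s := Ioi 0)).congr_fun (fun x hx => ?_) measurableSet_Ioi
      rw [← key x, posConvolution, indicator_of_mem hx]
    refine (h2.const_mul (Real.Gamma (1 - α))⁻¹).congr (Eventually.of_forall fun x => ?_)
    simp only
    field_simp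
  · have e : s ^ α = s * s ^ (α - 1) := by
      rw [Real.rpow_sub_one hs0.ne']; field_simp
    rw [hparts] at hI
    rw [e]
    apply mul_left_cancel₀ hG.ne'
    rw [hI]
    ring
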